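/- Let 0<q<1, r>0, p=q^{2r}, and [u] = q^{u²/r − u} Θ_p(q^{2u}). For n=3, m=1 and generic complex v,u₁,u₂,u₃ (with [1]≠0, [v−u_a]≠0, [u_a−u_j]≠0 for a≠j), the elliptic partial fraction identity holds: ([v−u₁+1]/[v−u₁])·([v−u₂−1]/[v−u₂])·([v−u₃−1]/[v−u₃]) = Σ_{a=1}^{3} ([v−u_a−1]/([−1][v−u_a])) · [u_a−u₁+1][u_a−u₂−1][u_a−u₃−1] / ∏_{j≠a}[u_a−u_j], where in the numerator product of the a-th term the factor with index equal to a is [1] (for a=1) or [−1] (for a=2,3). -/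

import Mathlib

noncomputable def pinf (x p : ℂ) : ℂ := ∏' n : ℕ, (1 - x * p ^ n)

noncomputable def Theta (p z : ℂ) : ℂ := pinf z p * pinf (p / z) p * pinf p p

noncomputable def br (q r : ℝ) (u : ℂ) : ℂ :=
  (q : ℂ) ^ (u ^ 2 / (r : ℂ) - u) * Theta ((q : ℂ) ^ ((2 * r : ℝ) : ℂ)) ((q : ℂ) ^ (2 * u))

open Filter Topology

/-- Gaussian binomial coefficients, evaluated at a real number. -/
def gaussBinom (p : ℝ) : ℕ → ℕ → ℝ
  | _, 0 => 1
  | 0, _ + 1 => 0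
  | n + 1, k + 1 => p ^ (k + 1) * gaussBinom p n (k + 1) + gaussBinom p n k

/-- The finite `q`-Pochhammer product `(p; p)_n`. -/
def finitePoch (p : ℝ) (n : ℕ) : ℝ := ∏ k ∈ Finset.range n, (1 - p ^ (k + 1))

lemma gaussBinom_zero_right (p : ℝ) (n : ℕ) : gaussBinom p n 0 = 1 := by
  cases n <;> rfl

lemma gaussBinom_succ_succ (p : ℝ) (n k : ℕ) :
    gaussBinom p (n + 1) (k + 1) = p ^ (k + 1) * gaussBinom p n (k + 1) + gaussBinom p n k := rfl

lemma gaussBinom_eq_zero (p : ℝ) {n k : ℕ} (h : n < k) : gaussBinom p n k = 0 := by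
  induction n generalizing k with
  | zero => obtain ⟨k, rfl⟩ := Nat.exists_eq_add_of_lt h; simp [gaussBinom]
  | succ n ih =>
    obtain ⟨k, rfl⟩ : ∃ l, k = l + 1 := ⟨k - 1, by omega⟩
    rw [gaussBinom_succ_succ, ih (by omega), ih (by omega)]
    simp

lemma finitePoch_succ (p : ℝ) (n : ℕ) :
    finitePoch p (n + 1) = finitePoch p n * (1 - p ^ (n + 1)) :=
  Finset.prod_range_succ _ _

lemma gaussBinom_mul_finitePoch (p : ℝ) (n k : ℕ) :
    gaussBinom p (n + k) k * (finitePoch p k * finitePoch p n) = finitePoch p (n + k) := by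
  induction k generalizing n with
  | zero => simp [gaussBinom_zero_right, finitePoch]
  | succ k ih =>
    induction n with
    | zero =>
      have h := ih 0
      rw [zero_add] at h ⊢
      rw [gaussBinom_succ_succ, gaussBinom_eq_zero p (Nat.lt_succ_self k), finitePoch_succ]
      linear_combination (1 - p ^ (k + 1)) * h
    | succ n ihn =>
      have h := ih (n + 1)
      rw [show n + 1 + (k + 1) = n + 1 + k + 1 by ring, gaussBinom_succ_succ,
        finitePoch_succ p (n + 1 + k)]
      rw [show n + (k + 1) = n + 1 + k by ring] at ihn
      rw [finitePoch_succ] at h ihn ⊢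
      rw [finitePoch_succ p n] at ⊢
      linear_combination p ^ (k + 1) * (1 - p ^ (n + 1)) * ihn + (1 - p ^ (k + 1)) * h

lemma finitePoch_pos {p : ℝ} (h0 : 0 < p) (h1 : p < 1) (n : ℕ) : 0 < finitePoch p n :=
  Finset.prod_pos fun k _ => sub_pos.2 (pow_lt_one₀ h0.le h1 k.succ_ne_zero)

lemma gaussBinom_nonneg {p : ℝ} (h0 : 0 < p) (n k : ℕ) : 0 ≤ gaussBinom p n k := by
  induction n generalizing k with
  | zero => cases k <;> simp [gaussBinom]
  | succ n ih =>
    cases k with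
    | zero => simp [gaussBinom]
    | succ k =>
      rw [gaussBinom_succ_succ]
      have := ih k
      have := ih (k + 1)
      positivity

lemma finitePoch_antitone {p : ℝ} (h0 : 0 < p) (h1 : p < 1) : Antitone (finitePoch p) :=
  antitone_nat_of_succ_le fun n => by
    rw [finitePoch_succ]
    exact mul_le_of_le_one_right (finitePoch_pos h0 h1 n).le (by simp; positivity)

lemma gaussBinom_le {p : ℝ} (h0 : 0 < p) (h1 : p < 1) (n k : ℕ) :
    gaussBinom p n k ≤ (finitePoch p k)⁻¹ := by
  have hk := finitePoch_pos h0 h1 k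
  obtain h | h := lt_or_ge n k
  · rw [gaussBinom_eq_zero p h]
    positivity
  · obtain ⟨m, rfl⟩ := Nat.exists_eq_add_of_le' h
    have hm := finitePoch_pos h0 h1 m
    rw [← one_div, le_div_iff₀ hk, ← mul_le_mul_iff_left₀ hm, mul_assoc,
      gaussBinom_mul_finitePoch, one_mul]
    exact finitePoch_antitone h0 h1 (Nat.le_add_right m k)

lemma multipliable_pinf {p : ℂ} (hp : ‖p‖ < 1) (x : ℂ) :
    Multipliable fun n : ℕ => 1 - x * p ^ n := by
  simp_rw [sub_eq_add_neg]
  refine multipliable_one_add_of_summable ?_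
  simp_rw [norm_neg, norm_mul, norm_pow]
  exact (summable_geometric_of_lt_one (norm_nonneg _) hp).mul_left _

lemma tendsto_pinf {p : ℂ} (hp : ‖p‖ < 1) (x : ℂ) :
    Tendsto (fun n : ℕ => ∏ k ∈ Finset.range n, (1 - x * p ^ k)) atTop (𝓝 (pinf x p)) :=
  (multipliable_pinf hp x).hasProd.tendsto_prod_nat

lemma pinf_self_ne_zero {p : ℂ} (hp : ‖p‖ < 1) : pinf p p ≠ 0 := by
  have h (n : ℕ) : 1 + -(p * p ^ n) ≠ 0 := by
    intro h
    have h' : p ^ (n + 1) = 1 := by linear_combination -h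
    have := pow_lt_one₀ (norm_nonneg p) hp n.succ_ne_zero
    rw [← norm_pow, h', norm_one] at this
    exact lt_irrefl _ this
  have := tprod_one_add_ne_zero_of_summable (f := fun n : ℕ => -(p * p ^ n)) h (by
    simp_rw [norm_neg, norm_mul, norm_pow]
    exact (summable_geometric_of_lt_one (norm_nonneg _) hp).mul_left _)
  simpa only [pinf, sub_eq_add_neg] using this

lemma tendsto_finitePoch {p : ℝ} (h0 : 0 < p) (h1 : p < 1) :
    Tendsto (fun n => (finitePoch p n : ℂ)) atTop (𝓝 (pinf p p)) := by
  have hp : ‖(p : ℂ)‖ < 1 := by simpa [abs_of_pos h0] using h1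
  refine (tendsto_pinf hp p).congr fun n => ?_
  simp [finitePoch, pow_succ']

lemma exists_gaussBinom_le {p : ℝ} (h0 : 0 < p) (h1 : p < 1) :
    ∃ K : ℝ, ∀ n k, ‖(gaussBinom p n k : ℂ)‖ ≤ K := by
  have hp : ‖(p : ℂ)‖ < 1 := by simpa [abs_of_pos h0] using h1
  have h := ((tendsto_finitePoch h0 h1).inv₀ (pinf_self_ne_zero hp)).norm.bddAbove_range
  obtain ⟨K, hK⟩ := h
  refine ⟨K, fun n k => ?_⟩
  have h2 : ‖((finitePoch p k : ℂ))⁻¹‖ ≤ K := hK ⟨k, rfl⟩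
  rw [norm_inv, Complex.norm_of_nonneg (finitePoch_pos h0 h1 k).le] at h2
  rw [Complex.norm_of_nonneg (gaussBinom_nonneg h0 n k)]
  exact (gaussBinom_le h0 h1 n k).trans h2

lemma tendsto_gaussBinom {p : ℝ} (h0 : 0 < p) (h1 : p < 1) (j : ℤ) :
    Tendsto (fun n : ℕ => (gaussBinom p (2 * n) (j + n).toNat : ℂ)) atTop (𝓝 (pinf p p)⁻¹) := by
  have hp : ‖(p : ℂ)‖ < 1 := by simpa [abs_of_pos h0] using h1
  have hP := pinf_self_ne_zero hp
  have ht := tendsto_finitePoch h0 h1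
  have ha : Tendsto (fun n : ℕ => (j + n).toNat) atTop atTop :=
    tendsto_atTop.2 fun b => by
      filter_upwards [eventually_ge_atTop (b + j.natAbs)] with n hn
      omega
  have hb : Tendsto (fun n : ℕ => (n - j).toNat) atTop atTop :=
    tendsto_atTop.2 fun b => by
      filter_upwards [eventually_ge_atTop (b + j.natAbs)] with n hn
      omega
  have hc : Tendsto (fun n : ℕ => 2 * n) atTop atTop :=
    tendsto_atTop.2 fun b => by
      filter_upwards [eventually_ge_atTop b] with n hn
      omega
  have h := (ht.comp hc).div ((ht.comp ha).mul (ht.comp hb)) (mul_ne_zero hP hP)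
  rw [show pinf (p : ℂ) p / (pinf p p * pinf p p) = (pinf p p)⁻¹ by field_simp] at h
  refine h.congr' ?_
  filter_upwards [eventually_ge_atTop j.natAbs] with n hn
  have e := gaussBinom_mul_finitePoch p (n - j).toNat (j + n).toNat
  rw [show (n - j).toNat + (j + n).toNat = 2 * n by omega] at e
  have hb_ne := (finitePoch_pos h0 h1 (n - j).toNat).ne'
  have ha_ne := (finitePoch_pos h0 h1 (j + n).toNat).ne'
  simp only [Pi.div_apply, Function.comp_apply]
  rw [← e]
  push_cast
  have : (finitePoch p (n - j).toNat : ℂ) ≠ 0 := by exact_mod_cast hb_ne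
  have : (finitePoch p (j + n).toNat : ℂ) ≠ 0 := by exact_mod_cast ha_ne
  field_simp

/-- The `q`-binomial theorem, for a two-sided sequence `T` with the recursion of theta series. -/
lemma prod_mul_eq_sum_gaussBinom {p : ℝ} (h0 : 0 < p) {z : ℂ} (hz : z ≠ 0) {T : ℤ → ℂ}
    (hT : ∀ j, T (j + 1) = -z * (p : ℂ) ^ j * T j) (N : ℕ) (m : ℤ) :
    (∏ k ∈ Finset.range N, (1 - z * (p : ℂ) ^ m * (p : ℂ) ^ k)) * T m
      = ∑ k ∈ Finset.range (N + 1), (gaussBinom p N k : ℂ) * T (m + k) := by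
  have hp : (p : ℂ) ≠ 0 := by exact_mod_cast h0.ne'
  induction N generalizing m with
  | zero => simp [gaussBinom]
  | succ N ih =>
    have hs : ∑ k ∈ Finset.range (N + 1), (gaussBinom p N k : ℂ) * (p : ℂ) ^ k * T (m + k)
        = (∏ k ∈ Finset.range N, (1 - z * (p : ℂ) ^ (m + 1) * (p : ℂ) ^ k)) * T m := by
      have hne : -z * (p : ℂ) ^ m ≠ 0 := mul_ne_zero (neg_ne_zero.2 hz) (zpow_ne_zero _ hp)
      apply mul_left_cancel₀ hne
      rw [mul_left_comm, ← hT, ih, Finset.mul_sum]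
      refine Finset.sum_congr rfl fun k _ => ?_
      rw [show m + 1 + (k : ℤ) = m + k + 1 by ring, hT, zpow_add₀ hp, zpow_natCast]
      ring
    have hprod : ∏ k ∈ Finset.range (N + 1), (1 - z * (p : ℂ) ^ m * (p : ℂ) ^ k)
        = (1 - z * (p : ℂ) ^ m) *
          ∏ k ∈ Finset.range N, (1 - z * (p : ℂ) ^ (m + 1) * (p : ℂ) ^ k) := by
      rw [Finset.prod_range_succ', pow_zero, mul_one, mul_comm]
      congr 1
      refine Finset.prod_congr rfl fun k _ => ?_
      rw [zpow_add₀ hp, zpow_one, pow_succ]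
      ring
    have hsum : ∑ k ∈ Finset.range (N + 2), (gaussBinom p (N + 1) k : ℂ) * T (m + k)
        = (∑ k ∈ Finset.range (N + 1), (gaussBinom p N k : ℂ) * (p : ℂ) ^ k * T (m + k))
          + ∑ k ∈ Finset.range (N + 1), (gaussBinom p N k : ℂ) * T (m + 1 + k) := by
      have hext := Finset.sum_range_succ
        (fun k : ℕ => (gaussBinom p N k : ℂ) * (p : ℂ) ^ k * T (m + k)) (N + 1)
      rw [gaussBinom_eq_zero p (Nat.lt_succ_self N), Complex.ofReal_zero, zero_mul, zero_mul,
        add_zero] at hext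
      rw [← hext, Finset.sum_range_succ' _ (N + 1), Finset.sum_range_succ' _ (N + 1),
        add_right_comm, ← Finset.sum_add_distrib]
      congr 1
      · refine Finset.sum_congr rfl fun k _ => ?_
        rw [gaussBinom_succ_succ]
        push_cast
        rw [show m + 1 + (k : ℤ) = m + (k + 1) by ring]
        ring
      · simp [gaussBinom_zero_right]
    rw [hsum, hs, ← ih (m + 1), hprod, hT]
    ring

lemma prod_mul_eq_of_recursion {p : ℝ} (h0 : 0 < p) {z : ℂ} (hz : z ≠ 0) {T : ℤ → ℂ}
    (hT : ∀ j, T (j + 1) = -z * (p : ℂ) ^ j * T j) (n : ℕ) :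
    (∏ k ∈ Finset.range n, (1 - z * (p : ℂ) ^ (-(n : ℤ)) * (p : ℂ) ^ k)) * T (-n)
      = (∏ k ∈ Finset.range n, (1 - p / z * (p : ℂ) ^ k)) * T 0 := by
  have hp : (p : ℂ) ≠ 0 := by exact_mod_cast h0.ne'
  induction n with
  | zero => simp
  | succ n ih =>
    rw [Finset.prod_range_succ (fun k => 1 - p / z * (p : ℂ) ^ k), mul_right_comm, ← ih,
      Finset.prod_range_succ', pow_zero, mul_one]
    have h := hT (-(n + 1 : ℕ))
    rw [show -((n + 1 : ℕ) : ℤ) + 1 = -n by push_cast; ring] at h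
    have hc : ∏ k ∈ Finset.range n, (1 - z * (p : ℂ) ^ (-((n + 1 : ℕ) : ℤ)) * (p : ℂ) ^ (k + 1))
        = ∏ k ∈ Finset.range n, (1 - z * (p : ℂ) ^ (-(n : ℤ)) * (p : ℂ) ^ k) := by
      refine Finset.prod_congr rfl fun k _ => ?_
      rw [show -(n : ℤ) = -((n + 1 : ℕ) : ℤ) + 1 by push_cast; ring, zpow_add₀ hp, zpow_one,
        pow_succ]
      ring
    have he : (p : ℂ) ^ (-((n + 1 : ℕ) : ℤ)) = ((p : ℂ) ^ n * p)⁻¹ := by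
      rw [zpow_neg, zpow_natCast, pow_succ]
    rw [hc, h, he]
    field_simp
    ring

/-- The Jacobi triple product identity. -/
lemma Theta_mul_eq_tsum {p : ℝ} (h0 : 0 < p) (h1 : p < 1) {z : ℂ} (hz : z ≠ 0) {T : ℤ → ℂ}
    (hT : ∀ j, T (j + 1) = -z * (p : ℂ) ^ j * T j) (hsum : Summable T) :
    Theta p z * T 0 = ∑' j, T j := by
  have hpc : (p : ℂ) ≠ 0 := by exact_mod_cast h0.ne'
  have hp : ‖(p : ℂ)‖ < 1 := by simpa [abs_of_pos h0] using h1
  obtain ⟨K, hK⟩ := exists_gaussBinom_le h0 h1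
  let F (n : ℕ) (j : ℤ) : ℂ :=
    if -(n : ℤ) ≤ j then (gaussBinom p (2 * n) (j + n).toNat : ℂ) * T j else 0
  have hF (n : ℕ) : ∑' j, F n j
      = (∏ k ∈ Finset.range n, (1 - z * (p : ℂ) ^ k)) *
        (∏ k ∈ Finset.range n, (1 - p / z * (p : ℂ) ^ k)) * T 0 := by
    have hinj : Function.Injective fun k : ℕ => (-(n : ℤ) + k) := fun a b h => by
      simpa using h
    have hpr := prod_mul_eq_sum_gaussBinom h0 hz hT (2 * n) (-n)
    rw [two_mul, Finset.prod_range_add, mul_right_comm, prod_mul_eq_of_recursion h0 hz hT] at hpr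
    have hc : ∏ k ∈ Finset.range n, (1 - z * (p : ℂ) ^ (-(n : ℤ)) * (p : ℂ) ^ (n + k))
        = ∏ k ∈ Finset.range n, (1 - z * (p : ℂ) ^ k) := by
      refine Finset.prod_congr rfl fun k _ => ?_
      rw [pow_add, zpow_neg, zpow_natCast]
      field_simp
    rw [hc, ← two_mul] at hpr
    have hs : HasSum (F n ∘ fun k : ℕ => (-(n : ℤ) + k))
        (∑ k ∈ Finset.range (2 * n + 1), (gaussBinom p (2 * n) k : ℂ) * T (-n + k)) := by
      have he : (F n ∘ fun k : ℕ => (-(n : ℤ) + k))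
          = fun k : ℕ => (gaussBinom p (2 * n) k : ℂ) * T (-n + k) := by
        funext k
        simp [F]
      rw [he]
      refine hasSum_sum_of_ne_finset_zero fun k hk => ?_
      rw [gaussBinom_eq_zero p (by simpa using hk)]
      simp
    rw [hinj.hasSum_iff] at hs
    · rw [hs.tsum_eq, ← hpr]
      ring
    · intro j hj
      refine if_neg fun h => hj ⟨(j + n).toNat, ?_⟩
      simp only
      omega
  have hlim1 : Tendsto (fun n => ∑' j, F n j) atTop (𝓝 (∑' j, (pinf p p)⁻¹ * T j)) := by
    refine tendsto_tsum_of_dominated_convergence (bound := fun j => K * ‖T j‖)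
      (hsum.norm.mul_left K) (fun j => ?_) (Eventually.of_forall fun n j => ?_)
    · refine ((tendsto_gaussBinom h0 h1 j).mul_const (T j)).congr' ?_
      filter_upwards [eventually_ge_atTop j.natAbs] with n hn
      exact (if_pos (by omega)).symm
    · by_cases h : -(n : ℤ) ≤ j
      · simp only [F, if_pos h, norm_mul]
        gcongr
        exact hK _ _
      · simp only [F, if_neg h, norm_zero]
        exact mul_nonneg ((norm_nonneg _).trans (hK 0 0)) (norm_nonneg _)
  have hlim2 : Tendsto (fun n => ∑' j, F n j) atTop (𝓝 (pinf z p * pinf (p / z) p * T 0)) := by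
    simp_rw [hF]
    exact ((tendsto_pinf hp z).mul (tendsto_pinf hp (p / z))).mul_const _
  have h := tendsto_nhds_unique hlim2 hlim1
  rw [tsum_mul_left] at h
  have hP := pinf_self_ne_zero hp
  rw [Theta, mul_right_comm, h]
  field_simp

lemma summable_cexp_quadratic {a : ℂ} (ha : a.re < 0) (b c : ℂ) :
    Summable fun j : ℤ => Complex.exp (a * j ^ 2 + b * j + c) := by
  have hpi : (Real.pi : ℂ) ≠ 0 := by exact_mod_cast Real.pi_ne_zero
  have hτ : 0 < (a / (Real.pi * Complex.I)).im := by
    have : a / (Real.pi * Complex.I) = ((Real.pi⁻¹ : ℝ) : ℂ) * (-(a * Complex.I)) := by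
      push_cast
      field_simp
      rw [Complex.I_sq]
      ring
    rw [this, Complex.im_ofReal_mul]
    simp only [Complex.neg_im, Complex.mul_I_im]
    exact mul_pos (inv_pos.2 Real.pi_pos) (neg_pos.2 ha)
  refine (((summable_jacobiTheta₂_term_iff (b / (2 * Real.pi * Complex.I))
    (a / (Real.pi * Complex.I))).2 hτ).mul_right (Complex.exp c)).congr fun j => ?_
  rw [jacobiTheta₂_term, ← Complex.exp_add]
  congr 1
  field_simp
  ring

/-- The terms of the theta series of `br q r u`. -/
noncomputable def brTerm (L r : ℝ) (u : ℂ) (j : ℤ) : ℂ :=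
  Complex.exp (Real.pi * Complex.I * j + L * ((u + r * j) ^ 2 / r - (u + r * j)))

lemma summable_brTerm {L r : ℝ} (hL : L < 0) (hr : 0 < r) (u : ℂ) : Summable (brTerm L r u) := by
  have hrc : (r : ℂ) ≠ 0 := by exact_mod_cast hr.ne'
  have ha : ((L * r : ℝ) : ℂ).re < 0 := by
    rw [Complex.ofReal_re]
    exact mul_neg_of_neg_of_pos hL hr
  refine (summable_cexp_quadratic ha (Real.pi * Complex.I + 2 * u * L - r * L)
    (L * (u ^ 2 / r - u))).congr fun j => ?_
  rw [brTerm]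
  congr 1
  push_cast
  field_simp
  ring

lemma br_eq_tsum {q r : ℝ} (hq0 : 0 < q) (hq1 : q < 1) (hr : 0 < r) (u : ℂ) :
    br q r u = ∑' j, brTerm (Real.log q) r u j := by
  have hrc : (r : ℂ) ≠ 0 := by exact_mod_cast hr.ne'
  have hqc : (q : ℂ) ≠ 0 := by exact_mod_cast hq0.ne'
  have hpow (w : ℂ) : (q : ℂ) ^ w = Complex.exp (Real.log q * w) := by
    rw [Complex.cpow_def_of_ne_zero hqc, Complex.ofReal_log hq0.le]
  have hp : (q : ℂ) ^ ((2 * r : ℝ) : ℂ) = ((q ^ (2 * r) : ℝ) : ℂ) :=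
    (Complex.ofReal_cpow hq0.le _).symm
  have hz : (q : ℂ) ^ (2 * u) ≠ 0 := by
    rw [hpow]
    exact Complex.exp_ne_zero _
  have h := Theta_mul_eq_tsum (Real.rpow_pos_of_pos hq0 (2 * r))
    (Real.rpow_lt_one hq0.le hq1 (by positivity)) hz (T := brTerm (Real.log q) r u) ?_
    (summable_brTerm (Real.log_neg hq0 hq1) hr u)
  · rw [← h, br, hp, mul_comm, hpow (u ^ 2 / r - u)]
    simp [brTerm]
  · intro j
    rw [← hp, hpow, hpow, ← Complex.exp_int_mul, brTerm, brTerm, neg_mul, neg_mul,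
      ← neg_one_mul, ← Complex.exp_pi_mul_I, ← Complex.exp_add, ← Complex.exp_add,
      ← Complex.exp_add]
    congr 1
    push_cast
    field_simp
    ring

lemma br_neg {q r : ℝ} (hq0 : 0 < q) (hq1 : q < 1) (hr : 0 < r) (u : ℂ) :
    br q r (-u) = -br q r u := by
  have hrc : (r : ℂ) ≠ 0 := by exact_mod_cast hr.ne'
  rw [br_eq_tsum hq0 hq1 hr, br_eq_tsum hq0 hq1 hr, ← tsum_neg,
    ← (Equiv.subLeft (1 : ℤ)).tsum_eq (brTerm (Real.log q) r (-u))]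
  refine tsum_congr fun j => ?_
  have h (w : ℂ) : -Complex.exp w = Complex.exp (Real.pi * Complex.I + w) := by
    rw [Complex.exp_add, Complex.exp_pi_mul_I, neg_one_mul]
  rw [Equiv.subLeft_apply, brTerm, brTerm, h, Complex.exp_eq_exp_iff_exists_int]
  refine ⟨-j, ?_⟩
  push_cast
  field_simp
  ring

/-- Pairs of integers, sorted by the parity of their sum. -/
noncomputable def intPairParityEquiv : (ℤ × ℤ) ⊕ (ℤ × ℤ) ≃ ℤ × ℤ :=
  Equiv.ofBijective
    (Sum.elim (fun s => (s.1 + s.2, s.1 - s.2)) fun s => (s.1 + s.2 + 1, s.1 - s.2)) <| by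
    constructor
    · rintro (⟨a, b⟩ | ⟨a, b⟩) (⟨c, d⟩ | ⟨c, d⟩) h <;>
        simp only [Sum.elim_inl, Sum.elim_inr, Prod.mk.injEq, Sum.inl.injEq, Sum.inr.injEq,
          reduceCtorEq] at h ⊢ <;> omega
    · rintro ⟨j, k⟩
      obtain h | h := Int.emod_two_eq_zero_or_one (j + k)
      · refine ⟨Sum.inl ((j + k) / 2, (j - k) / 2), ?_⟩
        simp only [Sum.elim_inl, Prod.mk.injEq]
        omega
      · refine ⟨Sum.inr ((j + k) / 2, (j - k) / 2), ?_⟩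
        simp only [Sum.elim_inr, Prod.mk.injEq]
        omega

lemma intPairParityEquiv_inl (s : ℤ × ℤ) :
    intPairParityEquiv (Sum.inl s) = (s.1 + s.2, s.1 - s.2) := rfl

lemma intPairParityEquiv_inr (s : ℤ × ℤ) :
    intPairParityEquiv (Sum.inr s) = (s.1 + s.2 + 1, s.1 - s.2) := rfl

lemma exists_br_add_mul_br_sub {q r : ℝ} (hq0 : 0 < q) (hq1 : q < 1) (hr : 0 < r) :
    ∃ a b c d : ℂ → ℂ, ∀ x y,
      br q r (x + y) * br q r (x - y) = a x * c y + b x * d y := by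
  have hrc : (r : ℂ) ≠ 0 := by exact_mod_cast hr.ne'
  have hL := Real.log_neg hq0 hq1
  set L := Real.log q with hLdef
  let A (ε x : ℂ) (m : ℤ) : ℂ := Complex.exp (Real.pi * Complex.I * ε +
    2 * L * ((x + r * (m + ε / 2)) ^ 2 / r - (x + r * (m + ε / 2))))
  let B (ε y : ℂ) (n : ℤ) : ℂ := Complex.exp (2 * L * ((y + r * (n + ε / 2)) ^ 2 / r))
  have ha : ((2 * L * r : ℝ) : ℂ).re < 0 := by
    rw [Complex.ofReal_re]
    nlinarith
  have hA (ε x : ℂ) : Summable (A ε x) := by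
    refine (summable_cexp_quadratic ha (2 * L * (2 * (x + r * ε / 2) - r))
      (Real.pi * Complex.I * ε + 2 * L * ((x + r * ε / 2) ^ 2 / r - (x + r * ε / 2)))).congr
      fun j => ?_
    simp only [A]
    congr 1
    push_cast
    field_simp
    ring
  have hB (ε y : ℂ) : Summable (B ε y) := by
    refine (summable_cexp_quadratic ha (2 * L * (2 * (y + r * ε / 2)))
      (2 * L * ((y + r * ε / 2) ^ 2 / r))).congr fun j => ?_
    simp only [B]
    congr 1
    push_cast
    field_simp
    ring
  have hAB (ε x y : ℂ) : HasSum (fun s : ℤ × ℤ => A ε x s.1 * B ε y s.2)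
      ((∑' m, A ε x m) * ∑' n, B ε y n) := by
    rw [tsum_mul_tsum_of_summable_norm (hA ε x).norm (hB ε y).norm]
    exact (summable_mul_of_summable_norm (hA ε x).norm (hB ε y).norm).hasSum
  refine ⟨fun x => ∑' m, A 0 x m, fun x => ∑' m, A 1 x m, fun y => ∑' n, B 0 y n,
    fun y => ∑' n, B 1 y n, fun x y => ?_⟩
  have h1 := (summable_brTerm hL hr (x + y)).norm
  have h2 := (summable_brTerm hL hr (x - y)).norm
  rw [br_eq_tsum hq0 hq1 hr, br_eq_tsum hq0 hq1 hr, ← hLdef,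
    tsum_mul_tsum_of_summable_norm h1 h2, ← intPairParityEquiv.tsum_eq]
  refine HasSum.tsum_eq (HasSum.sum (f := fun s => brTerm L r (x + y) (intPairParityEquiv s).1 *
    brTerm L r (x - y) (intPairParityEquiv s).2) ?_ ?_)
  · convert hAB 0 x y using 1
    funext s
    simp only [Function.comp_apply, intPairParityEquiv_inl, brTerm, A, B]
    rw [← Complex.exp_add, ← Complex.exp_add, Complex.exp_eq_exp_iff_exists_int]
    refine ⟨s.1, ?_⟩
    push_cast
    field_simp
    ring
  · convert hAB 1 x y using 1
    funext s
    simp only [Function.comp_apply, intPairParityEquiv_inr, brTerm, A, B]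
    rw [← Complex.exp_add, ← Complex.exp_add, Complex.exp_eq_exp_iff_exists_int]
    refine ⟨s.1, ?_⟩
    push_cast
    field_simp
    ring

/-- The Pfaffian of a skew-symmetric `4 × 4` array of rank at most two vanishes. -/
lemma pfaffian_eq_zero_of_rank_two {α K : Type*} [Field K] {S : α → α → K} (a b c d : α → K)
    (hS : ∀ x y, S x y = a x * c y + b x * d y) (hskew : ∀ x y, S y x = -S x y)
    (hdiag : ∀ x, S x x = 0) (x y z w : α) :
    S x y * S z w - S x z * S y w + S x w * S y z = 0 := by
  have key (x y z w : α) :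
      S x y * (S x y * S z w - S x z * S y w + S x w * S y z) = 0 := by
    have hminor : S x x * (S y y * S z w - S y w * S z y)
        - S x y * (S y x * S z w - S y w * S z x)
        + S x w * (S y x * S z y - S y y * S z x) = 0 := by
      simp only [hS]
      ring
    rw [hdiag x, hdiag y, hskew x y, hskew y z, hskew x z] at hminor
    linear_combination hminor
  by_contra hne
  have hxy : S x y = 0 := (mul_eq_zero.1 (key x y z w)).resolve_right hne
  have hxz : S x z = 0 := (mul_eq_zero.1 (key x z y w)).resolve_right fun h => hne <| by
    rw [hskew y z] at h
    linear_combination -h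
  have hxw : S x w = 0 := (mul_eq_zero.1 (key x w y z)).resolve_right fun h => hne <| by
    rw [hskew z w, hskew y w] at h
    linear_combination h
  exact hne (by rw [hxy, hxz, hxw]; ring)

/-- The three-term identity of Weierstrass. -/
lemma br_three_term {q r : ℝ} (hq0 : 0 < q) (hq1 : q < 1) (hr : 0 < r) (x y z w : ℂ) :
    br q r (x + y) * br q r (x - y) * (br q r (z + w) * br q r (z - w))
      - br q r (x + z) * br q r (x - z) * (br q r (y + w) * br q r (y - w))
      + br q r (x + w) * br q r (x - w) * (br q r (y + z) * br q r (y - z)) = 0 := by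
  obtain ⟨a, b, c, d, h⟩ := exists_br_add_mul_br_sub hq0 hq1 hr
  refine pfaffian_eq_zero_of_rank_two (S := fun x y => br q r (x + y) * br q r (x - y)) a b c d h
    (fun x y => ?_) (fun x => ?_) x y z w
  · rw [add_comm y x, ← neg_sub x y, br_neg hq0 hq1 hr]
    ring
  · have h0 := br_neg hq0 hq1 hr 0
    rw [neg_zero] at h0
    have : br q r 0 = 0 := by linear_combination h0 / 2
    simp [this]

theorem elliptic_partial_fraction_n3_m1 (q r : ℝ) (hq0 : 0 < q) (hq1 : q < 1) (hr : 0 < r)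
    (v u₁ u₂ u₃ : ℂ)
    (h1 : br q r 1 ≠ 0)
    (hv1 : br q r (v - u₁) ≠ 0) (hv2 : br q r (v - u₂) ≠ 0) (hv3 : br q r (v - u₃) ≠ 0)
    (h12 : br q r (u₁ - u₂) ≠ 0) (h13 : br q r (u₁ - u₃) ≠ 0)
    (h21 : br q r (u₂ - u₁) ≠ 0) (h23 : br q r (u₂ - u₃) ≠ 0)
    (h31 : br q r (u₃ - u₁) ≠ 0) (h32 : br q r (u₃ - u₂) ≠ 0) :
    (br q r (v - u₁ + 1) / br q r (v - u₁)) * (br q r (v - u₂ - 1) / br q r (v - u₂))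
        * (br q r (v - u₃ - 1) / br q r (v - u₃))
      = br q r (v - u₁ - 1) / (br q r (-1) * br q r (v - u₁))
          * (br q r (u₁ - u₁ + 1) * br q r (u₁ - u₂ - 1) * br q r (u₁ - u₃ - 1)
              / (br q r (u₁ - u₂) * br q r (u₁ - u₃)))
        + br q r (v - u₂ - 1) / (br q r (-1) * br q r (v - u₂))
            * (br q r (u₂ - u₁ + 1) * br q r (u₂ - u₂ - 1) * br q r (u₂ - u₃ - 1)
                / (br q r (u₂ - u₁) * br q r (u₂ - u₃)))
        + br q r (v - u₃ - 1) / (br q r (-1) * br q r (v - u₃))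
            * (br q r (u₃ - u₁ + 1) * br q r (u₃ - u₂ - 1) * br q r (u₃ - u₃ - 1)
                / (br q r (u₃ - u₁) * br q r (u₃ - u₂))) := by
  have hneg := br_neg hq0 hq1 hr
  have hsub : br q r (u₂ - u₁ + 1) = -br q r (u₁ - u₂ - 1) := by
    rw [← hneg]
    ring_nf
  have e1 : br q r (v - u₁ + 1) * br q r (v - u₂ - 1) * (br q r (u₁ - u₃) * br q r (u₂ - u₃))
      - br q r (u₃ - u₁ + 1) * br q r (u₃ - u₂ - 1) * (br q r (v - u₁) * br q r (v - u₂))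
      + br q r 1 * br q r (u₁ - u₂ - 1) * (br q r (v - u₃) * br q r (v - u₁ - u₂ + u₃)) = 0 := by
    have h := br_three_term hq0 hq1 hr (v - (u₁ + u₂) / 2) ((u₂ - u₁) / 2 + 1)
      (u₃ - (u₁ + u₂) / 2) ((u₂ - u₁) / 2)
    rw [show v - (u₁ + u₂) / 2 + ((u₂ - u₁) / 2 + 1) = v - u₁ + 1 by ring,
      show v - (u₁ + u₂) / 2 - ((u₂ - u₁) / 2 + 1) = v - u₂ - 1 by ring,
      show u₃ - (u₁ + u₂) / 2 + (u₂ - u₁) / 2 = -(u₁ - u₃) by ring,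
      show u₃ - (u₁ + u₂) / 2 - (u₂ - u₁) / 2 = -(u₂ - u₃) by ring,
      show v - (u₁ + u₂) / 2 + (u₃ - (u₁ + u₂) / 2) = v - u₁ - u₂ + u₃ by ring,
      show v - (u₁ + u₂) / 2 - (u₃ - (u₁ + u₂) / 2) = v - u₃ by ring,
      show (u₂ - u₁) / 2 + 1 + (u₂ - u₁) / 2 = u₂ - u₁ + 1 by ring,
      show (u₂ - u₁) / 2 + 1 - (u₂ - u₁) / 2 = 1 by ring,
      show v - (u₁ + u₂) / 2 + (u₂ - u₁) / 2 = v - u₁ by ring,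
      show v - (u₁ + u₂) / 2 - (u₂ - u₁) / 2 = v - u₂ by ring,
      show (u₂ - u₁) / 2 + 1 + (u₃ - (u₁ + u₂) / 2) = u₃ - u₁ + 1 by ring,
      show (u₂ - u₁) / 2 + 1 - (u₃ - (u₁ + u₂) / 2) = -(u₃ - u₂ - 1) by ring,
      hneg, hneg, hneg, hsub] at h
    linear_combination h
  have e2 : br q r 1 * br q r (u₁ - u₂) * (br q r (v - u₃ - 1) * br q r (v - u₁ - u₂ + u₃))
      - br q r (u₁ - u₃ - 1) * br q r (u₂ - u₃) * (br q r (v - u₁ - 1) * br q r (v - u₂))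
      + br q r (u₂ - u₃ - 1) * br q r (u₁ - u₃) * (br q r (v - u₂ - 1) * br q r (v - u₁)) = 0 := by
    have h := br_three_term hq0 hq1 hr (v - (u₁ + u₂ + 1) / 2) ((u₁ + u₂ - 1) / 2 - u₃)
      ((u₁ - u₂ + 1) / 2) ((u₂ - u₁ + 1) / 2)
    rw [show v - (u₁ + u₂ + 1) / 2 + ((u₁ + u₂ - 1) / 2 - u₃) = v - u₃ - 1 by ring,
      show v - (u₁ + u₂ + 1) / 2 - ((u₁ + u₂ - 1) / 2 - u₃) = v - u₁ - u₂ + u₃ by ring,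
      show (u₁ - u₂ + 1) / 2 + (u₂ - u₁ + 1) / 2 = 1 by ring,
      show (u₁ - u₂ + 1) / 2 - (u₂ - u₁ + 1) / 2 = u₁ - u₂ by ring,
      show v - (u₁ + u₂ + 1) / 2 + (u₁ - u₂ + 1) / 2 = v - u₂ by ring,
      show v - (u₁ + u₂ + 1) / 2 - (u₁ - u₂ + 1) / 2 = v - u₁ - 1 by ring,
      show (u₁ + u₂ - 1) / 2 - u₃ + (u₂ - u₁ + 1) / 2 = u₂ - u₃ by ring,
      show (u₁ + u₂ - 1) / 2 - u₃ - (u₂ - u₁ + 1) / 2 = u₁ - u₃ - 1 by ring,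
      show v - (u₁ + u₂ + 1) / 2 + (u₂ - u₁ + 1) / 2 = v - u₁ by ring,
      show v - (u₁ + u₂ + 1) / 2 - (u₂ - u₁ + 1) / 2 = v - u₂ - 1 by ring,
      show (u₁ + u₂ - 1) / 2 - u₃ + (u₁ - u₂ + 1) / 2 = u₁ - u₃ by ring,
      show (u₁ + u₂ - 1) / 2 - u₃ - (u₁ - u₂ + 1) / 2 = u₂ - u₃ - 1 by ring] at h
    linear_combination h
  have hswap (x y : ℂ) : br q r (y - x) = -br q r (x - y) := by rw [← hneg, neg_sub]
  rw [sub_self, sub_self, sub_self, zero_add, zero_sub, hneg 1, hsub, hswap u₁ u₂, hswap u₁ u₃,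
    hswap u₂ u₃]
  field_simp
  linear_combination br q r (u₁ - u₂) * br q r (v - u₃ - 1) * e1
    - br q r (u₁ - u₂ - 1) * br q r (v - u₃) * e2
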